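/- The projective variety V_4 ⊂ P^5 defined by y1y6 = y2y5 and y1y6 = y3y4 is an irreducible threefold whose singular locus consists of exactly six points, namely the six coordinate points of P^5. -/

import Mathlib

open MvPolynomial

/-- The quadric `y₁y₆ − y₂y₅`. -/
noncomputable def quad1 : MvPolynomial (Fin 6) ℂ := X 0 * X 5 - X 1 * X 4

/-- The quadric `y₁y₆ − y₃y₄`. -/
noncomputable def quad2 : MvPolynomial (Fin 6) ℂ := X 0 * X 5 - X 2 * X 3

/-- The homogeneous ideal of `V₄ ⊂ ℙ⁵`. -/
noncomputable def idealV4 : Ideal (MvPolynomial (Fin 6) ℂ) := Ideal.span {quad1, quad2}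

/-- The exponent map of the parametrization. -/
noncomputable def expV4 (m : Fin 6 →₀ ℕ) : Fin 4 →₀ ℕ :=
  Finsupp.equivFunOnFinite.symm
    ![m 0 + m 1 + m 2, m 0 + m 3 + m 4, m 1 + m 3 + m 5, m 2 + m 4 + m 5]

/-- The toric parametrization of the cone over `V₄`. -/
noncomputable def paramV4 : MvPolynomial (Fin 6) ℂ →ₐ[ℂ] MvPolynomial (Fin 4) ℂ :=
  aeval ![X 0 * X 1, X 0 * X 2, X 0 * X 3, X 1 * X 2, X 1 * X 3, X 2 * X 3]

lemma mon6 (m : Fin 6 →₀ ℕ) : (monomial m 1 : MvPolynomial (Fin 6) ℂ) =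
    X 0 ^ m 0 * X 1 ^ m 1 * X 2 ^ m 2 * X 3 ^ m 3 * X 4 ^ m 4 * X 5 ^ m 5 := by
  rw [MvPolynomial.monomial_eq, Finsupp.prod_fintype _ _ (by simp)]
  simp [Fin.prod_univ_six]

lemma mon4 (m : Fin 4 →₀ ℕ) : (monomial m 1 : MvPolynomial (Fin 4) ℂ) =
    X 0 ^ m 0 * X 1 ^ m 1 * X 2 ^ m 2 * X 3 ^ m 3 := by
  rw [MvPolynomial.monomial_eq, Finsupp.prod_fintype _ _ (by simp)]
  simp [Fin.prod_univ_four]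

lemma param_mon (m : Fin 6 →₀ ℕ) : paramV4 (monomial m 1) = monomial (expV4 m) 1 := by
  rw [mon6, mon4]
  simp [paramV4, expV4]
  ring

lemma ideal_le : idealV4 ≤ RingHom.ker paramV4 := by
  rw [idealV4, Ideal.span_le]
  rintro x (rfl | rfl)
  · simp [quad1, paramV4, RingHom.mem_ker]; ring
  · simp [quad2, paramV4, RingHom.mem_ker]; ring

/-- Normal form of a monomial modulo relations, in any ring. -/
lemma nf {A : Type*} [CommRing A] (x : Fin 6 → A) (h1 : x 0 * x 5 = x 1 * x 4)
    (h2 : x 0 * x 5 = x 2 * x 3) (a b c d e f : ℕ) :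
    x 0 ^ a * x 1 ^ b * x 2 ^ c * x 3 ^ d * x 4 ^ e * x 5 ^ f =
    x 0 ^ (a + min b e + min c d) * x 1 ^ (b - min b e) * x 2 ^ (c - min c d) *
     x 3 ^ (d - min c d) * x 4 ^ (e - min b e) * x 5 ^ (f + min b e + min c d) := by
  obtain ⟨r, b', e', hr, rfl, rfl⟩ : ∃ r b' e', min b e = r ∧ b = b' + r ∧ e = e' + r :=
    ⟨min b e, b - min b e, e - min b e, rfl, by omega, by omega⟩
  obtain ⟨s, c', d', hs, rfl, rfl⟩ : ∃ r b' e', min c d = r ∧ c = b' + r ∧ d = e' + r :=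
    ⟨min c d, c - min c d, d - min c d, rfl, by omega, by omega⟩
  rw [hr, hs]
  simp only [Nat.add_sub_cancel]
  have e1 : x 0 ^ r * x 5 ^ r = x 1 ^ r * x 4 ^ r := by rw [← mul_pow, h1, mul_pow]
  have e2 : x 0 ^ s * x 5 ^ s = x 2 ^ s * x 3 ^ s := by rw [← mul_pow, h2, mul_pow]
  calc _ = x 0 ^ a * x 1 ^ b' * x 2 ^ c' * x 3 ^ d' * x 4 ^ e' * x 5 ^ f *
        (x 1 ^ r * x 4 ^ r) * (x 2 ^ s * x 3 ^ s) := by ring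
    _ = _ := by rw [← e1, ← e2]; ring

lemma factors : Function.FactorsThrough
    (fun m : Fin 6 →₀ ℕ => Ideal.Quotient.mk idealV4 (monomial m 1)) expV4 := by
  intro m m' h
  have g0 := DFunLike.congr_fun h 0
  have g1 := DFunLike.congr_fun h 1
  have g2 := DFunLike.congr_fun h 2
  have g3 := DFunLike.congr_fun h 3
  simp [expV4] at g0 g1 g2 g3
  have h1 : Ideal.Quotient.mk idealV4 (X 0) * Ideal.Quotient.mk idealV4 (X 5) =
      Ideal.Quotient.mk idealV4 (X 1) * Ideal.Quotient.mk idealV4 (X 4) := by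
    rw [← map_mul, ← map_mul, Ideal.Quotient.eq]
    exact Ideal.subset_span (by simp [quad1])
  have h2 : Ideal.Quotient.mk idealV4 (X 0) * Ideal.Quotient.mk idealV4 (X 5) =
      Ideal.Quotient.mk idealV4 (X 2) * Ideal.Quotient.mk idealV4 (X 3) := by
    rw [← map_mul, ← map_mul, Ideal.Quotient.eq]
    exact Ideal.subset_span (by simp [quad2])
  have key := nf (fun i => Ideal.Quotient.mk idealV4 (X i)) h1 h2
  simp only [mon6, map_mul, map_pow]
  have e0 : m 0 + min (m 1) (m 4) + min (m 2) (m 3) =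
    m' 0 + min (m' 1) (m' 4) + min (m' 2) (m' 3) := by omega
  have e1 : m 1 - min (m 1) (m 4) = m' 1 - min (m' 1) (m' 4) := by omega
  have e2 : m 2 - min (m 2) (m 3) = m' 2 - min (m' 2) (m' 3) := by omega
  have e3 : m 3 - min (m 2) (m 3) = m' 3 - min (m' 2) (m' 3) := by omega
  have e4 : m 4 - min (m 1) (m 4) = m' 4 - min (m' 1) (m' 4) := by omega
  have e5 : m 5 + min (m 1) (m 4) + min (m 2) (m 3) =
    m' 5 + min (m' 1) (m' 4) + min (m' 2) (m' 3) := by omega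
  have k1 := key (m 0) (m 1) (m 2) (m 3) (m 4) (m 5)
  have k2 := key (m' 0) (m' 1) (m' 2) (m' 3) (m' 4) (m' 5)
  rw [e0, e1, e2, e3, e4, e5] at k1
  exact k1.trans k2.symm

lemma ker_param : RingHom.ker paramV4 = idealV4 := by
  refine le_antisymm ?_ ideal_le
  let σ : MvPolynomial (Fin 4) ℂ →ₗ[ℂ] (MvPolynomial (Fin 6) ℂ ⧸ idealV4) :=
    (basisMonomials (Fin 4) ℂ).constr ℂ (Function.extend expV4
      (fun m : Fin 6 →₀ ℕ => Ideal.Quotient.mk idealV4 (monomial m 1)) 0)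
  have hσ : σ ∘ₗ paramV4.toLinearMap = (Ideal.Quotient.mkₐ ℂ idealV4).toLinearMap := by
    refine (basisMonomials (Fin 6) ℂ).ext fun m => ?_
    have := (basisMonomials (Fin 4) ℂ).constr_basis ℂ (Function.extend expV4
      (fun m : Fin 6 →₀ ℕ => Ideal.Quotient.mk idealV4 (monomial m 1)) 0) (expV4 m)
    rw [factors.extend_apply, coe_basisMonomials] at this
    simp only [coe_basisMonomials, LinearMap.comp_apply, AlgHom.toLinearMap_apply, param_mon]
    exact this
  intro f hf
  rw [RingHom.mem_ker] at hf
  have := LinearMap.congr_fun hσ f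
  simp only [LinearMap.comp_apply, AlgHom.toLinearMap_apply] at this
  rw [show paramV4 f = 0 from hf, map_zero] at this
  exact Ideal.Quotient.eq_zero_iff_mem.mp this.symm

lemma prime_V4 : idealV4.IsPrime := by
  rw [← ker_param]; exact RingHom.ker_isPrime _

lemma quad1_prime : Prime quad1 := by
  have : Irreducible (X 0 * X 5 + (-(X 1 * X 4)) : MvPolynomial (Fin 6) ℂ) := by
    apply irreducible_mul_X_add
    · exact X_ne_zero _
    · simp [vars_X]
    · rw [vars_neg]
      intro h
      have := vars_mul _ _ h
      simp [vars_X] at this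
    · rw [(X_prime (i := (0 : Fin 6)) (R := ℂ)).irreducible.isRelPrime_iff_not_dvd]
      intro h
      have := map_dvd (eval (![0, 1, 1, 1, 1, 1] : Fin 6 → ℂ)) h
      simp at this
  rw [quad1, sub_eq_add_neg]
  exact this.prime

lemma dim_upper : ringKrullDim (MvPolynomial (Fin 6) ℂ ⧸ idealV4) ≤ 4 := by
  have hd : ringKrullDim (MvPolynomial (Fin 6) ℂ) = 6 := by
    rw [MvPolynomial.ringKrullDim_of_isNoetherianRing, ringKrullDim_eq_zero_of_field]
    simp
  have hp : (Ideal.span {quad1}).IsPrime :=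
    (Ideal.span_singleton_prime quad1_prime.ne_zero).mpr quad1_prime
  have h1 := ringKrullDim_quotient_succ_le_of_nonZeroDivisor
    (mem_nonZeroDivisors_of_ne_zero quad1_prime.ne_zero)
  have hq : Ideal.Quotient.mk (Ideal.span {quad1}) quad2 ≠ 0 := by
    rw [Ne, Ideal.Quotient.eq_zero_iff_mem, Ideal.mem_span_singleton]
    intro h
    have := map_dvd (eval (![0, 0, 1, 1, 0, 0] : Fin 6 → ℂ)) h
    simp [quad1, quad2] at this
  have hle : Ideal.span {quad1} ≤ idealV4 := Ideal.span_mono (by simp)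
  have h2 := ringKrullDim_succ_le_of_surjective
    (Ideal.Quotient.factor hle) (Ideal.Quotient.factor_surjective hle)
    (mem_nonZeroDivisors_of_ne_zero hq)
    (by
      rw [Ideal.Quotient.factor_mk, Ideal.Quotient.eq_zero_iff_mem]
      exact Ideal.subset_span (by simp))
  rw [hd] at h1
  have h3 : ringKrullDim (MvPolynomial (Fin 6) ℂ ⧸ idealV4) + 1 + 1 ≤ 6 :=
    (add_le_add_left h2 1).trans h1
  have h4 : ringKrullDim (MvPolynomial (Fin 6) ℂ ⧸ idealV4) + 2 ≤ 4 + 2 := by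
    rw [add_assoc] at h3
    norm_num at h3 ⊢
    exact h3
  revert h4
  generalize ringKrullDim (MvPolynomial (Fin 6) ℂ ⧸ idealV4) = d
  intro h4
  induction d with
  | bot => exact bot_le
  | coe d =>
    have h5 : d + 2 ≤ 4 + 2 := WithBot.coe_le_coe.mp h4
    have h6 : d ≤ 4 := (ENat.add_le_add_iff_right (by decide)).mp h5
    exact WithBot.coe_le_coe.mpr h6

lemma dim_lower : 4 ≤ ringKrullDim (MvPolynomial (Fin 6) ℂ ⧸ idealV4) := by
  have := prime_V4
  have hd : ringKrullDim (MvPolynomial (Fin 3) ℂ) = 3 := by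
    rw [MvPolynomial.ringKrullDim_of_isNoetherianRing, ringKrullDim_eq_zero_of_field]
    simp
  let g : MvPolynomial (Fin 6) ℂ →ₐ[ℂ] MvPolynomial (Fin 3) ℂ :=
    aeval ![0, 0, 0, X 0, X 1, X 2]
  have hg : ∀ a ∈ idealV4, g a = 0 := by
    have : idealV4 ≤ RingHom.ker g := by
      rw [idealV4, Ideal.span_le]
      rintro x (rfl | rfl)
      · simp [quad1, g, RingHom.mem_ker]
      · simp [quad2, g, RingHom.mem_ker]
    exact fun a ha => this ha
  have hs : Function.Surjective g := by
    intro p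
    refine ⟨rename ![3, 4, 5] p, ?_⟩
    simp only [g, aeval_rename]
    have : (![0, 0, 0, X 0, X 1, X 2] : Fin 6 → MvPolynomial (Fin 3) ℂ) ∘ ![3, 4, 5] = X := by
      ext i : 1
      fin_cases i <;> rfl
    rw [this, aeval_X_left_apply]
  have hx : Ideal.Quotient.mk idealV4 (X 0) ≠ 0 := by
    rw [Ne, Ideal.Quotient.eq_zero_iff_mem, ← ker_param, RingHom.mem_ker]
    simp [paramV4]
  have := ringKrullDim_succ_le_of_surjective
    (Ideal.Quotient.lift idealV4 (g : MvPolynomial (Fin 6) ℂ →+* MvPolynomial (Fin 3) ℂ) hg)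
    (Ideal.Quotient.lift_surjective_of_surjective _ _ hs)
    (mem_nonZeroDivisors_of_ne_zero hx) (by simp [g])
  rw [hd] at this
  norm_num at this
  exact this

theorem stmt19 :
    idealV4.IsPrime ∧
    ringKrullDim (MvPolynomial (Fin 6) ℂ ⧸ idealV4) = 4 ∧
    (∀ y : Fin 6 → ℂ, y ≠ 0 →
      eval y quad1 = 0 → eval y quad2 = 0 →
      ((∃ a b : ℂ, (a, b) ≠ (0, 0) ∧
          ∀ i, a * eval y (pderiv i quad1) + b * eval y (pderiv i quad2) = 0) ↔
        ∃ i, y i ≠ 0 ∧ ∀ j, j ≠ i → y j = 0)) := by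
  refine ⟨prime_V4, le_antisymm dim_upper dim_lower, ?_⟩
  intro y hy h1 h2
  have hne : ∃ i, y i ≠ 0 := by
    by_contra! h
    exact hy (funext h)
  simp [quad1] at h1
  simp [quad2] at h2
  constructor
  · rintro ⟨a, b, hab, h⟩
    have g0 := h 0
    have g1 := h 1
    have g2 := h 2
    have g3 := h 3
    have g4 := h 4
    have g5 := h 5
    simp [quad1, quad2, pderiv_X] at g0 g1 g2 g3 g4 g5
    have hab' : ¬ (a = 0 ∧ b = 0) := by simpa using hab
    have g0' : a + b = 0 ∨ y 5 = 0 := by rw [← mul_eq_zero]; linear_combination g0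
    have g5' : a + b = 0 ∨ y 0 = 0 := by rw [← mul_eq_zero]; linear_combination g5
    have p : ∀ i j : Fin 6, y i * y j = 0 → (∀ k, k ≠ i → k ≠ j → y k = 0) →
        ∃ i, y i ≠ 0 ∧ ∀ j, j ≠ i → y j = 0 := by
      intro i j hij hk
      obtain ⟨l, hl⟩ := hne
      refine ⟨l, hl, fun m hm => ?_⟩
      rcases mul_eq_zero.mp hij with h0 | h0 <;> grind
    by_cases ha : a = 0
    · have hb : b ≠ 0 := fun hb => hab' ⟨ha, hb⟩
      have z0 : y 0 = 0 := g5'.resolve_left (by simpa [ha] using hb)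
      have z5 : y 5 = 0 := g0'.resolve_left (by simpa [ha] using hb)
      have z2 := g3.resolve_left hb
      have z3 := g2.resolve_left hb
      refine p 1 4 (by linear_combination -h1 + y 5 * z0) ?_
      intro k hk1 hk2
      fin_cases k <;> simp_all
    · have z1 := g4.resolve_left ha
      have z4 := g1.resolve_left ha
      by_cases hb : b = 0
      · have z0 : y 0 = 0 := g5'.resolve_left (by simpa [hb] using ha)
        have z5 : y 5 = 0 := g0'.resolve_left (by simpa [hb] using ha)
        refine p 2 3 (by linear_combination -h2 + y 5 * z0) ?_
        intro k hk1 hk2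
        fin_cases k <;> simp_all
      · have z2 := g3.resolve_left hb
        have z3 := g2.resolve_left hb
        refine p 0 5 (by linear_combination h1 + y 4 * z1) ?_
        intro k hk1 hk2
        fin_cases k <;> simp_all
  · rintro ⟨i, -, h⟩
    fin_cases i <;> simp [Fin.forall_fin_succ] at h
    · refine ⟨1, -1, by simp, ?_⟩
      simp [quad1, quad2, pderiv_X, Pi.single_apply, Fin.forall_fin_succ, h]
    · refine ⟨0, 1, by simp, ?_⟩
      simp [quad1, quad2, pderiv_X, Pi.single_apply, Fin.forall_fin_succ, h]
    · refine ⟨1, 0, by simp, ?_⟩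
      simp [quad1, quad2, pderiv_X, Pi.single_apply, Fin.forall_fin_succ, h]
    · refine ⟨1, 0, by simp, ?_⟩
      simp [quad1, quad2, pderiv_X, Pi.single_apply, Fin.forall_fin_succ, h]
    · refine ⟨0, 1, by simp, ?_⟩
      simp [quad1, quad2, pderiv_X, Pi.single_apply, Fin.forall_fin_succ, h]
    · refine ⟨1, -1, by simp, ?_⟩
      simp [quad1, quad2, pderiv_X, Pi.single_apply, Fin.forall_fin_succ, h]
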